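/- arXiv:2512.13839 — 2 statements merged into one kernel-verified Lean document; each statement's English description precedes it below -/
import Mathlib

section
/- Let p be a prime and G a finite p-group. Let 𝒵̄ = { Z(g) : g ∈ G } be the set of all element centers of G, a finite poset under inclusion with unique minimal element Z(G), and let μ : 𝒵̄ → ℤ be the (unique) function satisfying μ(Z(G)) = 1 and, for each Z ∈ 𝒵̄ with Z ≠ Z(G), μ(Z) = −∑_{Z' ∈ 𝒵̄, Z' ⊊ Z} μ(Z'). Then for every g ∈ G, the integer |Z*(g)| / |Z(G)| is congruent to μ(Z(g)) modulo p. -/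
open scoped Classical

/-- An element lies in the element center of `g` iff its own element center is contained in it. -/
theorem Set.mem_centralizer_centralizer_singleton_iff {G : Type*} [Group G] (x g : G) :
    x ∈ Set.centralizer (Set.centralizer {g}) ↔
      Set.centralizer (Set.centralizer {x}) ⊆ Set.centralizer (Set.centralizer {g}) := by
  refine ⟨fun hx => Set.centralizer_subset fun y hy => ?_,
    fun h => h (Set.subset_centralizer_centralizer rfl)⟩
  rw [Set.mem_centralizer_iff]
  rintro _ rfl
  exact (hx y hy).symm

theorem Set.centralizer_centralizer_singleton_eq_iff {G : Type*} [Group G] (x g : G) :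
    Set.centralizer (Set.centralizer {x}) = Set.centralizer (Set.centralizer {g}) ↔
      Set.centralizer {x} = Set.centralizer {g} := by
  refine ⟨fun h => ?_, fun h => by rw [h]⟩
  rw [← Set.centralizer_centralizer_centralizer {x}, h,
    Set.centralizer_centralizer_centralizer]

theorem Set.centralizer_singleton_mul_center {G : Type*} [Group G] (x : G) {z : G}
    (hz : z ∈ Subgroup.center G) :
    Set.centralizer {x * z} = Set.centralizer {x} := by
  ext y
  have hc := Subgroup.mem_center_iff.mp hz y
  simp only [Set.mem_centralizer_iff, Set.mem_singleton_iff, forall_eq]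
  rw [mul_assoc, ← hc, ← mul_assoc, ← mul_assoc, mul_left_inj]

theorem Set.coe_center_subset_centralizer {G : Type*} [Group G] (s : Set G) :
    (Subgroup.center G : Set G) ⊆ Set.centralizer s :=
  fun _ hz y _ => Subgroup.mem_center_iff.mp hz y

/-- The order of the center divides the size of every centralizer equivalence class. -/
theorem Subgroup.card_center_dvd_card_centralizer_eq {G : Type*} [Group G] (g : G) :
    Nat.card (Subgroup.center G) ∣
      Nat.card {x : G | Set.centralizer {x} = Set.centralizer {g}} := by
  set S := {x : G | Set.centralizer {x} = Set.centralizer {g}} with hS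
  have h : (QuotientGroup.mk : G → G ⧸ Subgroup.center G) ⁻¹' (QuotientGroup.mk '' S) = S := by
    refine Set.Subset.antisymm ?_ (Set.subset_preimage_image _ _)
    rintro x ⟨y, hy, hxy⟩
    have hz := QuotientGroup.eq.mp hxy
    have hx := Set.centralizer_singleton_mul_center y hz
    rw [mul_inv_cancel_left] at hx
    exact hx.trans hy
  rw [← h, Nat.card_congr (QuotientGroup.preimageMkEquivSubgroupProdSet _ _), Nat.card_prod]
  exact dvd_mul_right _ _

/-- In a finite `p`-group, the index of a proper subgroup of a subgroup is divisible by `p`. -/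
theorem IsPGroup.exists_card_eq_mul_of_lt {p : ℕ} (hp : p.Prime) {G : Type*} [Group G]
    [Finite G] (hG : IsPGroup p G) {H K : Subgroup G} (h : H < K) :
    ∃ m, Nat.card K = Nat.card H * (p * m) := by
  have := Fact.mk hp
  obtain ⟨a, ha⟩ := IsPGroup.iff_card.mp (hG.to_subgroup H)
  obtain ⟨b, hb⟩ := IsPGroup.iff_card.mp (hG.to_subgroup K)
  have hlt : Nat.card H < Nat.card K :=
    Set.ncard_lt_ncard (SetLike.coe_ssubset_coe.mpr h) (Set.toFinite _)
  rw [ha, hb] at hlt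
  have hab := (Nat.pow_lt_pow_iff_right hp.one_lt).mp hlt
  refine ⟨p ^ (b - a - 1), ?_⟩
  rw [ha, hb, ← pow_succ', ← pow_add]
  congr 1
  omega

theorem zstar_card_div_center_card_congr_moebius
    (p : ℕ) (hp : p.Prime) (G : Type*) [Group G] [Fintype G] (hG : IsPGroup p G)
    (Zbar : Finset (Set G))
    (hZbar : Zbar =
      Finset.univ.image (fun g : G => Set.centralizer (Set.centralizer {g})))
    (μ : Set G → ℤ)
    (hμ0 : μ ((Subgroup.center G : Set G)) = 1)
    (hμ : ∀ Z ∈ Zbar, Z ≠ (Subgroup.center G : Set G) →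
      μ Z = -∑ Z' ∈ Zbar.filter (fun Z' => Z' ⊂ Z), μ Z')
    (g : G) :
    ((Nat.card {x : G | Set.centralizer {x} = Set.centralizer {g}} /
        Nat.card (Subgroup.center G) : ℕ) : ℤ) ≡
      μ (Set.centralizer (Set.centralizer {g})) [ZMOD (p : ℤ)] := by
  let cl : G → Set G := fun x => Set.centralizer (Set.centralizer {x})
  let q := Nat.card (Subgroup.center G)
  have hq : 0 < q := Nat.card_pos
  let f : Set G → ℕ := fun Z => (Finset.univ.filter fun x => cl x = Z).card / q
  have hclass : ∀ x, (Finset.univ.filter fun y => cl y = cl x).card =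
      Nat.card {y : G | Set.centralizer {y} = Set.centralizer {x}} := fun x => by
    simp only [cl, Set.centralizer_centralizer_singleton_eq_iff]
    rw [Nat.card_eq_fintype_card, ← Set.toFinset_card]
    congr 1
    ext y
    simp
  have hmem : ∀ x, cl x ∈ Zbar := fun x => by simp [hZbar, cl]
  have hf : ∀ x, q * f (cl x) = (Finset.univ.filter fun y => cl y = cl x).card := fun x =>
    Nat.mul_div_cancel' (hclass x ▸ Subgroup.card_center_dvd_card_centralizer_eq x)
  have hsum : ∀ x, q * ∑ Z ∈ Zbar.filter (fun Z => Z ⊆ cl x), f Z = Nat.card (cl x) := by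
    intro x
    have hcard : Nat.card (cl x) = (Finset.univ.filter fun y => y ∈ cl x).card := by
      rw [Nat.card_eq_fintype_card, ← Set.toFinset_card]
      congr 1
      ext y
      simp
    rw [hcard, Finset.mul_sum, Finset.card_eq_sum_card_fiberwise (f := cl)
      (t := Zbar.filter (fun Z => Z ⊆ cl x))]
    · refine Finset.sum_congr rfl fun Z hZ => ?_
      obtain ⟨hZ, hZx⟩ := Finset.mem_filter.mp hZ
      rw [hZbar] at hZ
      obtain ⟨y, -, rfl⟩ := Finset.mem_image.mp hZ
      refine (hf y).trans ?_
      congr 1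
      ext w
      simp only [Finset.mem_filter, Finset.mem_univ, true_and]
      refine ⟨fun hw => ⟨?_, hw⟩, fun hw => hw.2⟩
      exact (Set.mem_centralizer_centralizer_singleton_iff w x).mpr (hw.trans_subset hZx)
    · intro w hw
      simp only [Finset.coe_filter, Finset.mem_univ, true_and, Set.mem_ofPred_eq] at hw ⊢
      exact ⟨hmem w, (Set.mem_centralizer_centralizer_singleton_iff w x).mp hw⟩
  have hsplit : ∀ x, ∑ Z ∈ Zbar.filter (fun Z => Z ⊆ cl x), f Z =
      f (cl x) + ∑ Z ∈ Zbar.filter (fun Z => Z ⊂ cl x), f Z := fun x => by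
    rw [← Finset.sum_insert (by simp)]
    refine Finset.sum_congr ?_ fun _ _ => rfl
    ext Z
    simp only [Finset.mem_filter, Finset.mem_insert]
    constructor
    · rintro ⟨h, h'⟩
      exact (eq_or_ssubset_of_subset h').imp_right fun hlt => ⟨h, hlt⟩
    · rintro (rfl | ⟨h, h'⟩)
      exacts [⟨hmem x, subset_rfl⟩, ⟨h, h'.subset⟩]
  have key : ∀ Z : Set G, Z ∈ Zbar → (f Z : ℤ) ≡ μ Z [ZMOD (p : ℤ)] := by
    intro Z
    induction Z using WellFoundedLT.induction with
    | ind Z ih =>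
      intro hZ
      obtain ⟨x, -, rfl⟩ := Finset.mem_image.mp (hZbar ▸ hZ)
      change (f (cl x) : ℤ) ≡ μ (cl x) [ZMOD (p : ℤ)]
      have hx := hsum x
      rw [hsplit x] at hx
      by_cases hc : cl x = (Subgroup.center G : Set G)
      · have hempty : Zbar.filter (fun Z => Z ⊂ cl x) = ∅ := by
          refine Finset.filter_eq_empty_iff.mpr fun Z hZ hlt => ?_
          obtain ⟨y, -, rfl⟩ := Finset.mem_image.mp (hZbar ▸ hZ)
          rw [hc] at hlt
          exact hlt.not_subset (Set.coe_center_subset_centralizer _)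
        rw [hempty, Finset.sum_empty, add_zero, hc] at hx
        have h1 : f (cl x) = 1 := by
          rw [hc]
          exact Nat.eq_of_mul_eq_mul_left hq (hx.trans (mul_one q).symm)
        rw [h1, hc, hμ0]
        rfl
      · have hlt : Subgroup.center G < Subgroup.centralizer (Set.centralizer {x}) :=
          SetLike.coe_ssubset_coe.mp
            ((Set.coe_center_subset_centralizer _).ssubset_of_ne (Ne.symm hc))
        obtain ⟨m, hm⟩ := hG.exists_card_eq_mul_of_lt hp hlt
        have hpm : f (cl x) + ∑ Z ∈ Zbar.filter (fun Z => Z ⊂ cl x), f Z = p * m :=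
          Nat.eq_of_mul_eq_mul_left hq (hx.trans hm)
        have hs : (∑ Z ∈ Zbar.filter (fun Z => Z ⊂ cl x), (f Z : ℤ)) ≡
            ∑ Z ∈ Zbar.filter (fun Z => Z ⊂ cl x), μ Z [ZMOD (p : ℤ)] :=
          Int.ModEq.sum fun Z hZ =>
            ih Z (Finset.mem_filter.mp hZ).2 (Finset.mem_filter.mp hZ).1
        have hfx : (f (cl x) : ℤ) =
            p * m + -∑ Z ∈ Zbar.filter (fun Z => Z ⊂ cl x), (f Z : ℤ) := by
          have : (f (cl x) : ℤ) + ∑ Z ∈ Zbar.filter (fun Z => Z ⊂ cl x), (f Z : ℤ) = p * m := by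
            exact_mod_cast hpm
          linarith
        rw [hμ _ (hmem x) hc, hfx]
        refine Int.ModEq.trans ?_ hs.neg
        simp [Int.ModEq]
  rw [← hclass g]
  exact key _ (hmem g)
end

section
/- Let p be a prime and G a finite nonabelian p-group. Let 𝒵(G) = { Z(g) : g ∈ G, g ∉ Z(G) } be the set of non-central element centers, and let μ : 𝒵(G) ∪ {Z(G)} → ℤ be the (unique) function satisfying μ(Z(G)) = 1 and, for each Z in the poset with Z ≠ Z(G), μ(Z) = −∑_{Z' in the poset, Z' ⊊ Z} μ(Z'). Then for every centralizer H ∈ 𝔠(G) properly containing Z(G), one has ∑_{Z ∈ 𝒵(G), Z ⊆ H} μ(Z) ≡ −1 (mod p). -/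
open scoped Classical

/-- If `g` lies in a centralizer, then so does its element center. -/
lemma centralizer_centralizer_singleton_subset_iff {G : Type*} [Group G] (S : Set G) (g : G) :
    Set.centralizer (Set.centralizer {g}) ⊆ Set.centralizer S ↔ g ∈ Set.centralizer S := by
  constructor
  · intro h
    exact h (Set.subset_centralizer_centralizer rfl)
  · intro hg
    apply Set.centralizer_subset
    intro s hs
    rw [Set.mem_centralizer_iff]
    rintro _ rfl
    exact (hg s hs).symm

/-- The element center of `g` is the center of the group exactly when `g` is central. -/
lemma centralizer_centralizer_singleton_eq_center_iff {G : Type*} [Group G] (g : G) :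
    Set.centralizer (Set.centralizer {g}) = (Subgroup.center G : Set G) ↔
      g ∈ Subgroup.center G := by
  constructor
  · intro h
    rw [← SetLike.mem_coe, ← h]
    exact Set.subset_centralizer_centralizer rfl
  · intro hg
    have h1 : Set.centralizer ({g} : Set G) = Set.univ :=
      Set.centralizer_eq_top_iff_subset.mpr (Set.singleton_subset_iff.mpr hg)
    rw [h1, Set.centralizer_univ]
    rfl

/-- In a finite `p`-group, `p` times the order of a subgroup divides the order of every strictly
larger subgroup. -/
lemma IsPGroup.card_mul_dvd_card_of_lt {p : ℕ} (hp : p.Prime) {G : Type*} [Group G] [Finite G]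
    (hG : IsPGroup p G) {K L : Subgroup G} (h : K < L) :
    Nat.card K * p ∣ Nat.card L := by
  have : Fact p.Prime := ⟨hp⟩
  obtain ⟨a, ha⟩ := IsPGroup.iff_card.mp (hG.to_subgroup K)
  obtain ⟨b, hb⟩ := IsPGroup.iff_card.mp (hG.to_subgroup L)
  have hlt : Nat.card K < Nat.card L := Set.Finite.card_lt_card (Set.toFinite _) h
  rw [ha, hb] at hlt ⊢
  rw [← pow_succ]
  exact pow_dvd_pow p ((Nat.pow_lt_pow_iff_right hp.one_lt).mp hlt)

/-- A centralizer is partitioned by the fibres of `g ↦ Z(g)` over the element centers it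
contains. -/
lemma sum_card_elementCenter_fibres {G : Type*} [Group G] [Fintype G] (S : Set G) :
    ∑ Z ∈ (Finset.univ.image (fun g : G => Set.centralizer (Set.centralizer {g}))).filter
        (fun Z => Z ⊆ Set.centralizer S),
      (Finset.univ.filter (fun g : G => Set.centralizer (Set.centralizer {g}) = Z)).card =
      Nat.card (Subgroup.centralizer S) := by
  have h := Finset.card_eq_sum_card_fiberwise
    (f := fun g : G => Set.centralizer (Set.centralizer {g}))
    (s := Finset.univ.filter (fun g : G => g ∈ Set.centralizer S))
    (t := (Finset.univ.image (fun g : G => Set.centralizer (Set.centralizer {g}))).filter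
        (fun Z => Z ⊆ Set.centralizer S))
    (by
      intro g hg
      simpa [centralizer_centralizer_singleton_subset_iff] using hg)
  have hcard : Nat.card (Subgroup.centralizer S) =
      (Finset.univ.filter (fun g : G => g ∈ Set.centralizer S)).card := by
    rw [Nat.card_eq_fintype_card, Fintype.card_subtype]
    exact congrArg Finset.card (Finset.filter_congr fun _ _ => Iff.rfl)
  rw [hcard, h]
  refine Finset.sum_congr rfl fun Z hZ => ?_
  congr 1
  ext g
  simp only [Finset.mem_filter, Finset.mem_univ, true_and] at hZ ⊢
  constructor
  · rintro rfl
    exact ⟨(centralizer_centralizer_singleton_subset_iff S g).mp hZ.2, rfl⟩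
  · exact fun h => h.2

theorem sum_moebius_over_element_centers_in_centralizer
    (p : ℕ) (hp : p.Prime) (G : Type*) [Group G] [Fintype G] (hG : IsPGroup p G)
    (hna : ∃ a b : G, a * b ≠ b * a)
    (ZG : Finset (Set G))
    (hZG : ZG = (Finset.univ.filter (fun g : G => g ∉ Subgroup.center G)).image
        (fun g : G => Set.centralizer (Set.centralizer {g})))
    (μ : Set G → ℤ)
    (hμ0 : μ ((Subgroup.center G : Set G)) = 1)
    (hμ : ∀ Z ∈ insert ((Subgroup.center G : Set G)) ZG,
      Z ≠ (Subgroup.center G : Set G) →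
      μ Z = -∑ Z' ∈ (insert ((Subgroup.center G : Set G)) ZG).filter
          (fun Z' => Z' ⊂ Z), μ Z')
    (H : Set G) (hH : ∃ S : Set G, H = Set.centralizer S)
    (hZH : (Subgroup.center G : Set G) ⊂ H) :
    ∑ Z ∈ ZG.filter (fun Z => Z ⊆ H), μ Z ≡ -1 [ZMOD (p : ℤ)] := by
  have hP : insert (Subgroup.center G : Set G) ZG =
      Finset.univ.image (fun g : G => Set.centralizer (Set.centralizer {g})) := by
    ext Z
    simp only [hZG, Finset.mem_insert, Finset.mem_image, Finset.mem_filter, Finset.mem_univ,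
      true_and]
    constructor
    · rintro (rfl | ⟨g, -, rfl⟩)
      · exact ⟨1, (centralizer_centralizer_singleton_eq_center_iff 1).mpr (one_mem _)⟩
      · exact ⟨g, rfl⟩
    · rintro ⟨g, rfl⟩
      by_cases hg : g ∈ Subgroup.center G
      · exact Or.inl ((centralizer_centralizer_singleton_eq_center_iff g).mpr hg)
      · exact Or.inr ⟨g, hg, rfl⟩
  have hnot : (Subgroup.center G : Set G) ∉ ZG := by
    simp only [hZG, Finset.mem_image, Finset.mem_filter, Finset.mem_univ, true_and]
    rintro ⟨g, hg, h⟩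
    exact hg ((centralizer_centralizer_singleton_eq_center_iff g).mp h)
  rw [hP] at hμ
  set P := Finset.univ.image (fun g : G => Set.centralizer (Set.centralizer {g})) with hPdef
  set N : Set G → ℕ := fun Z =>
    (Finset.univ.filter (fun g : G => Set.centralizer (Set.centralizer {g}) = Z)).card with hN
  set z : ℕ := Nat.card (Subgroup.center G) with hz
  have hzpos : 0 < z := Nat.card_pos
  have hsum (S : Set G) (hS : (Subgroup.center G : Set G) ⊂ Set.centralizer S) :
      ∑ Z ∈ P.filter (fun Z => Z ⊆ Set.centralizer S), (N Z : ℤ) ≡ 0 [ZMOD (z * p : ℤ)] := by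
    rw [← Nat.cast_sum, sum_card_elementCenter_fibres S, Int.modEq_zero_iff_dvd]
    have hlt : Subgroup.center G < Subgroup.centralizer S := hS
    exact_mod_cast IsPGroup.card_mul_dvd_card_of_lt hp hG hlt
  have hcongr : ∀ Z ∈ P, z * μ Z ≡ N Z [ZMOD (z * p : ℤ)] := by
    intro Z
    induction Z using (wellFounded_lt (α := Set G)).induction with
    | _ Z ih =>
    intro hZ
    by_cases hc : Z = (Subgroup.center G : Set G)
    · subst hc
      have : N (Subgroup.center G : Set G) = z := by
        simp only [hN, hz, centralizer_centralizer_singleton_eq_center_iff]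
        rw [Nat.card_eq_fintype_card, Fintype.card_subtype]
      rw [this, hμ0, mul_one]
    · obtain ⟨g, -, rfl⟩ := Finset.mem_image.mp hZ
      have hlt : (Subgroup.center G : Set G) ⊂ Set.centralizer (Set.centralizer {g}) :=
        (Set.center_subset_centralizer _).ssubset_of_ne (Ne.symm hc)
      have hs := hsum _ hlt
      have hsplit : P.filter (fun Z => Z ⊆ Set.centralizer (Set.centralizer {g})) =
          insert (Set.centralizer (Set.centralizer {g}))
            (P.filter (fun Z => Z ⊂ Set.centralizer (Set.centralizer {g}))) := by
        ext Z
        simp only [Finset.mem_filter, Finset.mem_insert, subset_iff_ssubset_or_eq]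
        constructor
        · rintro ⟨h1, h2 | h2⟩
          · exact Or.inr ⟨h1, h2⟩
          · exact Or.inl h2
        · rintro (rfl | ⟨h1, h2⟩)
          · exact ⟨hZ, Or.inr rfl⟩
          · exact ⟨h1, Or.inl h2⟩
      rw [hsplit, Finset.sum_insert (by simp)] at hs
      rw [hμ _ hZ hc, mul_neg, Finset.mul_sum]
      have hrec := Int.ModEq.sum (n := (z * p : ℤ))
        (s := P.filter (fun Z => Z ⊂ Set.centralizer (Set.centralizer {g})))
        (f := fun Z => z * μ Z) (g := fun Z => (N Z : ℤ))
        (fun Z hZ' => ih Z (Finset.mem_filter.mp hZ').2 (Finset.mem_filter.mp hZ').1)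
      refine hrec.neg.trans ?_
      simpa using (hs.sub_right (∑ Z ∈ P.filter
        (fun Z => Z ⊂ Set.centralizer (Set.centralizer {g})), (N Z : ℤ))).symm
  obtain ⟨S, rfl⟩ := hH
  have htotal : z * ∑ Z ∈ P.filter (fun Z => Z ⊆ Set.centralizer S), μ Z ≡ z * 0
      [ZMOD (z * p : ℤ)] := by
    rw [Finset.mul_sum, mul_zero]
    exact (Int.ModEq.sum fun Z hZ => hcongr Z (Finset.mem_filter.mp hZ).1).trans (hsum S hZH)
  have hmod := Int.ModEq.mul_left_cancel' (by exact_mod_cast hzpos.ne') htotal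
  rw [← hP, Finset.filter_insert, if_pos hZH.1, Finset.sum_insert (by simp [hnot]), hμ0] at hmod
  simpa using hmod.sub_right 1
end
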